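/- Let G = (B,ψ,A) be a quantum graph with δ-form ψ and completely positive quantum adjacency matrix A, and let ε_G be the quantum edge indicator. Equip B⊗B with the B-valued inner product ⟨a⊗b, c⊗d⟩_B := ψ(a*c) b* d. Then for all x,y ∈ B, ⟨x·ε_G, y·ε_G⟩_B = (1/δ²) A(x* y). In particular A(x) = δ² ⟨ε_G, x·ε_G⟩_B. -/

import Mathlib

open scoped TensorProduct
open TensorProduct

noncomputable section


open scoped TensorProduct
open TensorProduct

noncomputable section

variable {B : Type*} [Ring B] [StarRing B] [Algebra ℂ B] [StarModule ℂ B]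
  [Module.Finite ℂ B] [Module.Free ℂ B]

/-- The multiplication map `m : B ⊗ B → B`. -/
abbrev mulMap (B : Type*) [Ring B] [Algebra ℂ B] : B ⊗[ℂ] B →ₗ[ℂ] B := LinearMap.mul' ℂ B

/-- `ψ ⊗ ψ` as a functional on `B ⊗ B`. -/
def psi2 (ψ : B →ₗ[ℂ] ℂ) : B ⊗[ℂ] B →ₗ[ℂ] ℂ :=
  (TensorProduct.lid ℂ ℂ).toLinearMap ∘ₗ TensorProduct.map ψ ψ

/-- `ψ ⊗ id : B ⊗ B → B`. -/
def psiOne (ψ : B →ₗ[ℂ] ℂ) : B ⊗[ℂ] B →ₗ[ℂ] B :=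
  (TensorProduct.lid ℂ B).toLinearMap ∘ₗ TensorProduct.map ψ LinearMap.id

/-- `ψ` is a faithful state. -/
def IsState (ψ : B →ₗ[ℂ] ℂ) : Prop :=
  ψ 1 = 1 ∧ (∀ x : B, 0 ≤ (ψ (star x * x)).re ∧ (ψ (star x * x)).im = 0) ∧
    ∀ x : B, ψ (star x * x) = 0 → x = 0

/-- `mstar` is the adjoint of multiplication w.r.t. the GNS inner products of `ψ`:
`⟪y ⊗ z, m*(x)⟫_{ψ⊗ψ} = ⟪y * z, x⟫_ψ`. -/
def IsAdjointMul (ψ : B →ₗ[ℂ] ℂ) (mstar : B →ₗ[ℂ] B ⊗[ℂ] B) : Prop :=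
  ∀ x y z : B, psi2 ψ ((star y ⊗ₜ[ℂ] star z) * mstar x) = ψ (star (y * z) * x)

/-- `ψ` is a `δ`-form: `m m* = δ² id`. -/
def IsDeltaForm (mstar : B →ₗ[ℂ] B ⊗[ℂ] B) (δ : ℝ) : Prop :=
  ∀ x : B, mulMap B (mstar x) = ((δ : ℂ)^2) • x

/-- `A` is a quantum adjacency matrix: `m (A ⊗ A) m* = δ² A`. -/
def IsQAdj (mstar : B →ₗ[ℂ] B ⊗[ℂ] B) (δ : ℝ) (A : B →ₗ[ℂ] B) : Prop :=
  ∀ x : B, mulMap B (TensorProduct.map A A (mstar x)) = ((δ : ℂ)^2) • A x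

/-- The quantum edge indicator `ε = (1/δ²)(1 ⊗ A) m*(1)`. -/
def edgeInd (mstar : B →ₗ[ℂ] B ⊗[ℂ] B) (δ : ℝ) (A : B →ₗ[ℂ] B) : B ⊗[ℂ] B :=
  (((δ : ℂ)^2)⁻¹) • (LinearMap.lTensor B A) (mstar 1)

/-- The `#`-multiplication on `B ⊗ B`: `(a⊗b)#(c⊗d) = (ac)⊗(db)` (i.e. `B ⊗ Bᵒᵖ`). -/
def hashMul (ξ η : B ⊗[ℂ] B) : B ⊗[ℂ] B :=
  (TensorProduct.congr (LinearEquiv.refl ℂ B) (MulOpposite.opLinearEquiv ℂ (M := B))).symm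
    ((TensorProduct.congr (LinearEquiv.refl ℂ B) (MulOpposite.opLinearEquiv ℂ (M := B))) ξ *
      (TensorProduct.congr (LinearEquiv.refl ℂ B) (MulOpposite.opLinearEquiv ℂ (M := B))) η)

/-- The (conjugate-linear) star operation on `B ⊗ B`, `star (a ⊗ b) = star a ⊗ star b`,
defined via a choice of basis. -/
def starT (ξ : B ⊗[ℂ] B) : B ⊗[ℂ] B :=
  ∑ p : Module.Free.ChooseBasisIndex ℂ B × Module.Free.ChooseBasisIndex ℂ B,
    (starRingEnd ℂ)
      (((Module.Free.chooseBasis ℂ B).tensorProduct (Module.Free.chooseBasis ℂ B)).repr ξ p) •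
      (star ((Module.Free.chooseBasis ℂ B) p.1) ⊗ₜ[ℂ] star ((Module.Free.chooseBasis ℂ B) p.2))

/-- The `B`-valued inner product on `B ⊗ B`: `⟨a⊗b, c⊗d⟩_B = ψ(a*c) b* d`. -/
def bip (ψ : B →ₗ[ℂ] ℂ) (ξ η : B ⊗[ℂ] B) : B := psiOne ψ (starT ξ * η)

/-- Positivity in a star ring. -/
def IsPosEl {R : Type*} [Ring R] [StarRing R] (x : R) : Prop := ∃ y, x = star y * y

/-- Complete positivity of a linear map on `B`. -/
def IsCP (A : B →ₗ[ℂ] B) : Prop :=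
  ∀ (n : ℕ) (M : Matrix (Fin n) (Fin n) B), IsPosEl M → IsPosEl (M.map A)

/-- The map `A_ξ : x ↦ δ² (ψ ⊗ 1)(x · ξ)`. -/
def Axi (ψ : B →ₗ[ℂ] ℂ) (δ : ℝ) (ξ : B ⊗[ℂ] B) : B →ₗ[ℂ] B :=
  ((δ : ℂ)^2) • ((psiOne ψ) ∘ₗ ((LinearMap.mul ℂ (B ⊗[ℂ] B)).flip ξ) ∘ₗ
    (Algebra.TensorProduct.includeLeft : B →ₐ[ℂ] B ⊗[ℂ] B).toLinearMap)

/-- The quantum edge correspondence `E_G = B · ε_G · B` as a subspace of `B ⊗ B`. -/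
def EGspan (mstar : B →ₗ[ℂ] B ⊗[ℂ] B) (δ : ℝ) (A : B →ₗ[ℂ] B) : Submodule ℂ (B ⊗[ℂ] B) :=
  Submodule.span ℂ
    {z : B ⊗[ℂ] B | ∃ x y : B, z = (x ⊗ₜ[ℂ] (1 : B)) * edgeInd mstar δ A * ((1 : B) ⊗ₜ[ℂ] y)}


section Functionals

variable {B : Type*} [Ring B] [Algebra ℂ B]

@[simp]
theorem psiOne_tmul (ψ : B →ₗ[ℂ] ℂ) (a b : B) : psiOne ψ (a ⊗ₜ[ℂ] b) = ψ a • b := by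
  simp [psiOne]

@[simp]
theorem psi2_tmul (ψ : B →ₗ[ℂ] ℂ) (a b : B) : psi2 ψ (a ⊗ₜ[ℂ] b) = ψ a * ψ b := by
  simp [psi2]

theorem map_mul_psiOne (ψ : B →ₗ[ℂ] ℂ) (z : B) (ξ : B ⊗[ℂ] B) :
    ψ (z * psiOne ψ ξ) = psi2 ψ ((1 ⊗ₜ[ℂ] z) * ξ) := by
  induction ξ with
  | zero => simp
  | tmul a b => simp
  | add ξ η hξ hη => simp only [map_add, mul_add, hξ, hη]

end Functionals

section StarMaps

variable {B : Type*} [Ring B] [StarRing B] [Algebra ℂ B]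

theorem IsState.eq_of_forall_mul {ψ : B →ₗ[ℂ] ℂ} (hψ : IsState ψ) {v w : B}
    (h : ∀ z, ψ (z * v) = ψ (z * w)) : v = w := by
  refine sub_eq_zero.mp (hψ.2.2 _ ?_)
  rw [mul_sub, map_sub, h, sub_self]

variable [StarModule ℂ B]

/-- A linear map whose values on all `star u * u` are self-adjoint commutes with `star`. -/
theorem map_star_of_selfAdjoint_on_squares {M : Type*} [AddCommGroup M] [Module ℂ M]
    [StarAddMonoid M] [StarModule ℂ M] (f : B →ₗ[ℂ] M)
    (hf : ∀ u : B, star (f (star u * u)) = f (star u * u)) (x : B) :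
    f (star x) = star (f x) := by
  have h0 := hf x
  have h1 := hf 1
  have h2 := hf (x + 1)
  have h3 := hf (Complex.I • x + 1)
  simp only [star_add, star_one, add_mul, mul_add, one_mul, mul_one, map_add, star_smul,
    smul_mul_assoc, mul_smul_comm, map_smul] at h0 h1 h2 h3
  simp only [Complex.star_def, Complex.conj_I, map_neg, neg_neg, smul_add, smul_smul, neg_mul,
    smul_neg, Complex.I_mul_I, one_smul, neg_smul] at h3
  rw [h0, h1] at h2 h3
  have e2 : star (f (star x)) + star (f x) = f (star x) + f x := by
    rw [← sub_eq_zero] at h2 ⊢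
    rw [← h2]; abel
  have e3 : Complex.I • (star (f (star x)) - star (f x)) = Complex.I • (f x - f (star x)) := by
    rw [← sub_eq_zero] at h3 ⊢
    rw [← h3]
    simp only [smul_sub]; abel
  have e4 : star (f (star x)) - star (f x) = f x - f (star x) :=
    smul_right_injective M Complex.I_ne_zero e3
  have e5 : (2 : ℂ) • f (star x) = (2 : ℂ) • star (f x) := by
    rw [two_smul, two_smul]
    rw [← sub_eq_zero] at e2 e4 ⊢
    rw [← sub_zero (0 : M)]
    nth_rewrite 1 [← e4]
    rw [← e2]
    abel
  exact smul_right_injective M two_ne_zero e5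

theorem IsState.map_star {ψ : B →ₗ[ℂ] ℂ} (hψ : IsState ψ) (x : B) : ψ (star x) = star (ψ x) :=
  map_star_of_selfAdjoint_on_squares ψ
    (fun u => Complex.conj_eq_iff_im.mpr (hψ.2.1 u).2) x

theorem IsCP.map_star {A : B →ₗ[ℂ] B} (hA : IsCP A) (x : B) : A (star x) = star (A x) := by
  refine map_star_of_selfAdjoint_on_squares A (fun u => ?_) x
  obtain ⟨Y, hY⟩ := hA 1 (Matrix.of fun _ _ => star u * u) ⟨Matrix.of fun _ _ => u, by
    ext i j; simp [Matrix.mul_apply, Matrix.star_apply]⟩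
  have h := congrFun (congrFun hY 0) 0
  simp only [Matrix.map_apply, Matrix.of_apply, Matrix.mul_apply, Matrix.star_apply,
    Fin.sum_univ_one] at h
  rw [h, star_mul, star_star]

end StarMaps

section StarTensor

variable {B : Type*} [Ring B] [StarRing B] [Algebra ℂ B] [Module.Finite ℂ B] [Module.Free ℂ B]

theorem starT_add (ξ η : B ⊗[ℂ] B) : starT (ξ + η) = starT ξ + starT η := by
  simp [starT, add_smul, Finset.sum_add_distrib]

theorem starT_smul (c : ℂ) (ξ : B ⊗[ℂ] B) : starT (c • ξ) = star c • starT ξ := by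
  simp [starT, mul_smul, Finset.smul_sum]

theorem starT_sum {ι : Type*} (s : Finset ι) (ξ : ι → B ⊗[ℂ] B) :
    starT (∑ i ∈ s, ξ i) = ∑ i ∈ s, starT (ξ i) :=
  map_sum (⟨⟨starT, by simp [starT]⟩, starT_add⟩ : B ⊗[ℂ] B →+ B ⊗[ℂ] B) ξ s

theorem starT_tmul [StarModule ℂ B] (a b : B) :
    starT (a ⊗ₜ[ℂ] b) = star a ⊗ₜ[ℂ] star b := by
  conv_rhs => rw [← (Module.Free.chooseBasis ℂ B).sum_repr a,
    ← (Module.Free.chooseBasis ℂ B).sum_repr b]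
  rw [star_sum, star_sum, TensorProduct.sum_tmul]
  simp only [TensorProduct.tmul_sum, starT, Fintype.sum_prod_type, star_smul,
    Module.Basis.tensorProduct_repr_tmul_apply, TensorProduct.smul_tmul_smul, smul_eq_mul,
    starRingEnd_apply, star_mul]

end StarTensor

section Comultiplication

variable {B : Type*} [Ring B] [StarRing B] [Algebra ℂ B]
  {ψ : B →ₗ[ℂ] ℂ} {mstar : B →ₗ[ℂ] B ⊗[ℂ] B}

theorem IsAdjointMul.psiOne_mul (hψ : IsState ψ) (hadj : IsAdjointMul ψ mstar) (x y : B) :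
    psiOne ψ ((y ⊗ₜ[ℂ] 1) * mstar x) = y * x :=
  hψ.eq_of_forall_mul fun z => by
    rw [map_mul_psiOne, ← mul_assoc]
    simpa [mul_assoc] using hadj x (star y) (star z)

variable {ι : Type*} {s : Finset ι} {a b : ι → B}

theorem IsAdjointMul.sum_map_mul_smul (hψ : IsState ψ) (hadj : IsAdjointMul ψ mstar)
    (ht : mstar 1 = ∑ i ∈ s, a i ⊗ₜ[ℂ] b i) (c : B) : ∑ i ∈ s, ψ (c * a i) • b i = c := by
  simpa [ht, Finset.mul_sum] using hadj.psiOne_mul hψ 1 c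

theorem IsAdjointMul.sum_map_mul_smul' (hψ : IsState ψ) (hadj : IsAdjointMul ψ mstar)
    (ht : mstar 1 = ∑ i ∈ s, a i ⊗ₜ[ℂ] b i) (c : B) : ∑ i ∈ s, ψ (b i * c) • a i = c :=
  hψ.eq_of_forall_mul fun z => by
    conv_rhs => rw [← hadj.sum_map_mul_smul hψ ht z]
    simp [Finset.mul_sum, Finset.sum_mul, mul_comm]

theorem IsAdjointMul.sum_tmul_psiOne (hψ : IsState ψ) (hadj : IsAdjointMul ψ mstar)
    (ht : mstar 1 = ∑ i ∈ s, a i ⊗ₜ[ℂ] b i) (ξ : B ⊗[ℂ] B) :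
    ∑ i ∈ s, a i ⊗ₜ[ℂ] psiOne ψ ((b i ⊗ₜ[ℂ] 1) * ξ) = ξ := by
  induction ξ with
  | zero => simp
  | tmul c d =>
    conv_rhs => rw [← hadj.sum_map_mul_smul' hψ ht c]
    simp [TensorProduct.sum_tmul, TensorProduct.smul_tmul]
  | add ξ η hξ hη =>
    simp only [mul_add, map_add, TensorProduct.tmul_add, Finset.sum_add_distrib, hξ, hη]

/-- `m*(x)` is obtained from `m*(1)` by adjoining, flipping and multiplying by `x`. -/
theorem IsAdjointMul.eq_sum_star [StarModule ℂ B] (hψ : IsState ψ) (hadj : IsAdjointMul ψ mstar)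
    (ht : mstar 1 = ∑ i ∈ s, a i ⊗ₜ[ℂ] b i) (x : B) :
    mstar x = ∑ i ∈ s, star (b i) ⊗ₜ[ℂ] (star (a i) * x) := by
  have key (y : B) : psiOne ψ ((y ⊗ₜ[ℂ] 1) * ∑ i ∈ s, star (b i) ⊗ₜ[ℂ] (star (a i) * x)) =
      y * x := by
    have h := congrArg star (hadj.sum_map_mul_smul' hψ ht (star y))
    simp only [star_sum, star_smul, ← hψ.map_star, star_mul, star_star] at h
    conv_rhs => rw [← h]
    simp [Finset.mul_sum, Finset.sum_mul]
  refine (hadj.sum_tmul_psiOne hψ ht (mstar x)).symm.trans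
    (Eq.trans ?_ (hadj.sum_tmul_psiOne hψ ht _))
  simp only [key, hadj.psiOne_mul hψ]

theorem IsAdjointMul.bip_edgeInd [StarModule ℂ B] [Module.Finite ℂ B] [Module.Free ℂ B]
    (hψ : IsState ψ) (hadj : IsAdjointMul ψ mstar) {δ : ℝ} (hδ : δ ≠ 0) {A : B →ₗ[ℂ] B}
    (hA : IsQAdj mstar δ A) (hAs : ∀ x, A (star x) = star (A x)) (x y : B) :
    bip ψ ((x ⊗ₜ[ℂ] (1 : B)) * edgeInd mstar δ A) ((y ⊗ₜ[ℂ] (1 : B)) * edgeInd mstar δ A) =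
      (((δ : ℂ)^2)⁻¹) • A (star x * y) := by
  have hδ' : (δ : ℂ) ≠ 0 := Complex.ofReal_ne_zero.mpr hδ
  obtain ⟨s, ht⟩ := TensorProduct.exists_finset (mstar 1)
  have hε (z : B) : (z ⊗ₜ[ℂ] (1 : B)) * edgeInd mstar δ A =
      (((δ : ℂ)^2)⁻¹) • ∑ i ∈ s, (z * i.1) ⊗ₜ[ℂ] A i.2 := by
    simp [edgeInd, ht, Finset.mul_sum]
  have hsum (i : B × B) :
      ∑ j ∈ s, ψ (star (x * i.1) * (y * j.1)) • A j.2 = A (star i.1 * (star x * y)) := by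
    conv_rhs => rw [← hadj.sum_map_mul_smul hψ ht (star i.1 * (star x * y))]
    simp [mul_assoc]
  have hm := hA (star x * y)
  rw [hadj.eq_sum_star hψ ht] at hm
  simp only [map_sum, TensorProduct.map_tmul, LinearMap.mul'_apply, hAs] at hm
  have hstar : star (((δ : ℂ)^2)⁻¹) = ((δ : ℂ)^2)⁻¹ := by simp
  rw [hε, hε, bip, starT_smul, starT_sum, hstar]
  simp only [starT_tmul, smul_mul_smul_comm, map_smul, Finset.sum_mul, Finset.mul_sum,
    Algebra.TensorProduct.tmul_mul_tmul, map_sum, psiOne_tmul]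
  simp only [← mul_smul_comm]
  rw [Finset.sum_comm]
  simp only [← Finset.mul_sum, hsum, hm, smul_smul]
  congr 1
  field_simp

end Comultiplication

/-- `⟨x·ε_G, y·ε_G⟩_B = (1/δ²) A(x* y)`, and in particular `A(x) = δ² ⟨ε_G, x·ε_G⟩_B`. -/
theorem stmt_8 {B : Type*} [Ring B] [StarRing B] [Algebra ℂ B] [StarModule ℂ B]
    [Module.Finite ℂ B] [Module.Free ℂ B]
    (ψ : B →ₗ[ℂ] ℂ) (hψ : IsState ψ)
    (mstar : B →ₗ[ℂ] B ⊗[ℂ] B) (hadj : IsAdjointMul ψ mstar)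
    (δ : ℝ) (hδ : 0 < δ) (hdelta : IsDeltaForm mstar δ)
    (A : B →ₗ[ℂ] B) (hA : IsQAdj mstar δ A) (hcp : IsCP A) :
    (∀ x y : B,
      bip ψ ((x ⊗ₜ[ℂ] (1 : B)) * edgeInd mstar δ A) ((y ⊗ₜ[ℂ] (1 : B)) * edgeInd mstar δ A) =
        (((δ : ℂ)^2)⁻¹) • A (star x * y)) ∧
    (∀ x : B,
      A x = ((δ : ℂ)^2) • bip ψ (edgeInd mstar δ A) ((x ⊗ₜ[ℂ] (1 : B)) * edgeInd mstar δ A)) := by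
  have h := hadj.bip_edgeInd hψ hδ.ne' hA hcp.map_star
  refine ⟨h, fun x => ?_⟩
  have h1 := h 1 x
  rw [← Algebra.TensorProduct.one_def, one_mul, star_one, one_mul] at h1
  rw [h1, smul_inv_smul₀ (pow_ne_zero 2 (Complex.ofReal_ne_zero.mpr hδ.ne'))]

end
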